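/- Let x be a rational number with |x| < 1/(a + b√m). Then L⁻(x) := (1−ax)/(1−2ax−x²) is an integer if and only if x = F⁻_{2n}/F⁻_{2n+1} for some n ≥ 0 or x = L⁻_{2n+1}/L⁻_{2n+2} for some n ≥ 0. -/

import Mathlib

/-- `Lm a n` : L⁻_0 = 1, L⁻_1 = a, L⁻_{n+2} = 2a L⁻_{n+1} + L⁻_n. -/
def Lm (a : ℤ) : ℕ → ℤ
  | 0 => 1
  | 1 => a
  | n + 2 => 2 * a * Lm a (n + 1) + Lm a n

/-- `Fm a b n` : F⁻_0 = 0, F⁻_1 = b, F⁻_{n+2} = 2a F⁻_{n+1} + F⁻_n. -/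
def Fm (a b : ℤ) : ℕ → ℤ
  | 0 => 0
  | 1 => b
  | n + 2 => 2 * a * Fm a b (n + 1) + Fm a b n

theorem Fm_eq_mul (a b : ℤ) (n : ℕ) : Fm a b n = b * Fm a 1 n := by
  induction n using Nat.twoStepInduction with
  | zero => simp [Fm]
  | one => simp [Fm]
  | more n h₁ h₂ => simp only [Fm, h₁, h₂]; ring

theorem Lm_Fm_succ (a : ℤ) (n : ℕ) :
    Lm a (n + 1) = a * Lm a n + (a ^ 2 + 1) * Fm a 1 n ∧
      Fm a 1 (n + 1) = Lm a n + a * Fm a 1 n := by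
  induction n with
  | zero => simp [Lm, Fm]
  | succ n ih =>
    obtain ⟨h₁, h₂⟩ := ih
    constructor
    · rw [Lm]; linear_combination a * h₁ - (a ^ 2 + 1) * h₂
    · rw [Fm]; linear_combination a * h₂ - h₁

theorem Lm_sq_sub (a : ℤ) (n : ℕ) :
    Lm a n ^ 2 - (a ^ 2 + 1) * Fm a 1 n ^ 2 = (-1) ^ n := by
  induction n with
  | zero => simp [Lm, Fm]
  | succ n ih =>
    rw [(Lm_Fm_succ a n).1, (Lm_Fm_succ a n).2]; linear_combination -ih

theorem Lm_Fm_two_mul (a : ℤ) (n : ℕ) :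
    Lm a (2 * n) = Lm a n ^ 2 + (a ^ 2 + 1) * Fm a 1 n ^ 2 ∧
      Fm a 1 (2 * n) = 2 * Lm a n * Fm a 1 n := by
  induction n with
  | zero => simp [Lm, Fm]
  | succ n ih =>
    rw [show 2 * (n + 1) = 2 * n + 1 + 1 by ring, (Lm_Fm_succ a (2 * n + 1)).1,
      (Lm_Fm_succ a (2 * n + 1)).2, (Lm_Fm_succ a (2 * n)).1, (Lm_Fm_succ a (2 * n)).2,
      (Lm_Fm_succ a n).1, (Lm_Fm_succ a n).2, ih.1, ih.2]
    constructor <;> ring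

theorem Lm_pos_Fm_nonneg {a : ℤ} (ha : 0 < a) (n : ℕ) : 0 < Lm a n ∧ 0 ≤ Fm a 1 n := by
  induction n with
  | zero => simp [Lm, Fm]
  | succ n ih =>
    obtain ⟨h₁, h₂⟩ := ih
    rw [(Lm_Fm_succ a n).1, (Lm_Fm_succ a n).2]
    constructor <;> positivity

theorem Fm_succ_pos {a : ℤ} (ha : 0 < a) (n : ℕ) : 0 < Fm a 1 (n + 1) := by
  obtain ⟨h₁, h₂⟩ := Lm_pos_Fm_nonneg ha n
  rw [(Lm_Fm_succ a n).2]
  positivity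

/-- Every nonnegative solution of `X² - (a² + 1) Y² = ±1` is of the form `(Lm a n, Fm a 1 n)`. -/
theorem exists_eq_Lm_Fm {a : ℤ} (ha : 0 < a) (N : ℕ) (X Y : ℤ) (hN : Y.toNat = N)
    (hX : 0 ≤ X) (hY : 0 ≤ Y)
    (h : X ^ 2 - (a ^ 2 + 1) * Y ^ 2 = 1 ∨ X ^ 2 - (a ^ 2 + 1) * Y ^ 2 = -1) :
    ∃ n, X = Lm a n ∧ Y = Fm a 1 n := by
  induction N using Nat.strong_induction_on generalizing X Y with
  | _ N ih =>
  rcases hY.eq_or_lt with rfl | hY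
  · refine ⟨0, ?_, rfl⟩
    rcases h with h | h <;> simp only [Lm] <;> nlinarith
  have hY1 : 1 ≤ Y ^ 2 := by nlinarith
  have hge : (a ^ 2 + 1) * Y ^ 2 - 1 ≤ X ^ 2 := by rcases h with h | h <;> linarith
  have hle : X ^ 2 ≤ (a ^ 2 + 1) * Y ^ 2 + 1 := by rcases h with h | h <;> linarith
  have h₁ : a * Y ≤ X := abs_le_of_sq_le_sq' (by nlinarith) hX |>.2
  have h₂ : X < (a + 1) * Y := by
    refine lt_of_pow_lt_pow_left₀ 2 (by positivity) ?_
    nlinarith [mul_pos ha (lt_of_lt_of_le one_pos hY1)]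
  have h₃ : a * X ≤ (a ^ 2 + 1) * Y := by
    refine abs_le_of_sq_le_sq' ?_ (by positivity) |>.2
    nlinarith [mul_le_mul_of_nonneg_left hle (sq_nonneg a),
      mul_le_mul_of_nonneg_left hY1 (sq_nonneg a)]
  obtain ⟨n, hn₁, hn₂⟩ := ih (X - a * Y).toNat (by
      have : X - a * Y < Y := by linarith
      omega) ((a ^ 2 + 1) * Y - a * X) (X - a * Y) rfl (by linarith) (by linarith) (by
      rcases h with h | h
      · right; linear_combination -h
      · left; linear_combination -h)
  refine ⟨n + 1, ?_, ?_⟩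
  · rw [(Lm_Fm_succ a n).1, ← hn₁, ← hn₂]; ring
  · rw [(Lm_Fm_succ a n).2, ← hn₁, ← hn₂]; ring

theorem bounds_of_abs_lt_radius {m a b : ℤ} (hm : 0 < m) (ha : 0 < a) (hb : 0 < b)
    (hab : a ^ 2 - m * b ^ 2 = -1) {x : ℚ}
    (hx : |(x : ℝ)| < 1 / ((a : ℝ) + (b : ℝ) * Real.sqrt (m : ℝ))) :
    -1 < x ∧ 0 < 1 - 2 * (a : ℚ) * x - x ^ 2 ∧ 0 < 1 - (a : ℚ) * x := by
  have ha' : (1 : ℝ) ≤ a := by exact_mod_cast ha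
  have hb' : (0 : ℝ) < b := by exact_mod_cast hb
  have hm' : (0 : ℝ) < m := by exact_mod_cast hm
  have hab' : (a : ℝ) ^ 2 - m * b ^ 2 = -1 := by exact_mod_cast hab
  set β : ℝ := b * Real.sqrt m with hβ
  have hβ0 : 0 < β := by positivity
  have hβ2 : β ^ 2 = a ^ 2 + 1 := by
    rw [hβ, mul_pow, Real.sq_sqrt hm'.le]; linarith
  have hinv : 1 / ((a : ℝ) + β) = β - a := by
    rw [div_eq_iff (by positivity)]; linear_combination -hβ2
  rw [hinv, abs_lt] at hx
  obtain ⟨h₁, h₂⟩ := hx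
  have hβ1 : β < a + 1 := by nlinarith
  have key : (0 : ℝ) < 1 - 2 * a * x - x ^ 2 := by
    nlinarith [mul_pos (show (0 : ℝ) < β - a - x by linarith)
      (show (0 : ℝ) < β + a + x by linarith)]
  refine ⟨?_, by exact_mod_cast key, ?_⟩
  · have : (-1 : ℝ) < x := by linarith
    exact_mod_cast this
  · have : (0 : ℝ) < 1 - a * x := by nlinarith [sq_nonneg (x : ℝ)]
    exact_mod_cast this

/-- If the generating function takes the positive integer value `k` at `x`, then `2 k - 1` and
the square root of the discriminant form a term of odd index in the Pell sequence. -/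
theorem exists_index_of_value {a k : ℤ} (ha : 0 < a) (hk : 0 < k) {x : ℚ} (hx : -1 < x)
    (h : 1 - (a : ℚ) * x = k * (1 - 2 * a * x - x ^ 2)) :
    ∃ s : ℕ, 2 * k - 1 = Fm a 1 (2 * s + 1) ∧ 2 * (k : ℚ) * x = Fm a 1 (2 * s) := by
  have hk1 : (1 : ℚ) ≤ k := by exact_mod_cast hk
  have ha1 : (1 : ℚ) ≤ a := by exact_mod_cast ha
  have hsq : (2 * k * x + a * (2 * k - 1)) ^ 2 =
      (((a ^ 2 + 1) * (2 * k - 1) ^ 2 - 1 : ℤ) : ℚ) := by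
    push_cast; linear_combination 4 * k * h
  obtain ⟨D, hD⟩ := Rat.isSquare_intCast_iff.1 ⟨_, (hsq.symm.trans (sq _))⟩
  have hDD : ((D : ℚ)) ^ 2 = (2 * k * x + a * (2 * k - 1)) ^ 2 := by
    rw [hsq, hD]; push_cast; ring
  have hpos : 0 ≤ 2 * k * x + a * (2 * k - 1) := by
    by_contra! hneg
    have h₁ : (a * (2 * k - 1) : ℚ) ≤ -(2 * k * x + a * (2 * k - 1)) := by
      refine abs_le_of_sq_le_sq' ?_ (by linarith) |>.2
      rw [neg_sq, hsq]; push_cast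
      nlinarith
    nlinarith
  have habs : ((|D| : ℤ) : ℚ) = 2 * k * x + a * (2 * k - 1) := by
    rw [Int.cast_abs, ← abs_of_nonneg hpos]
    exact (sq_eq_sq_iff_abs_eq_abs _ _).1 hDD
  have hnorm : |D| ^ 2 - (a ^ 2 + 1) * (2 * k - 1) ^ 2 = -1 := by
    rw [sq_abs]; linear_combination -hD
  obtain ⟨N, hN₁, hN₂⟩ := exists_eq_Lm_Fm ha _ |D| (2 * k - 1) rfl (abs_nonneg D) (by linarith)
    (Or.inr hnorm)
  have hodd : Odd N := by
    rw [hN₁, hN₂, Lm_sq_sub] at hnorm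
    exact (neg_one_pow_eq_neg_one_iff_odd (by norm_num)).1 hnorm
  obtain ⟨s, rfl⟩ := hodd
  refine ⟨s, hN₂, ?_⟩
  have h₃ : Fm a 1 (2 * s) = |D| - a * (2 * k - 1) := by
    rw [hN₁, hN₂, (Lm_Fm_succ a (2 * s)).1, (Lm_Fm_succ a (2 * s)).2]; ring
  rw [h₃]; push_cast
  rw [← Int.cast_abs, habs]; ring

theorem L_minus_int_iff_conv (m a b : ℤ) (hm : 0 < m) (hns : ¬ IsSquare m)
    (ha : 0 < a) (hb : 0 < b) (hab : a ^ 2 - m * b ^ 2 = -1)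
    (hmin : ∀ x y : ℤ, 0 < x → 0 < y →
      (x ^ 2 - m * y ^ 2 = 1 ∨ x ^ 2 - m * y ^ 2 = -1) → a ≤ x ∧ b ≤ y)
    (x : ℚ) (hconv : |(x : ℝ)| < 1 / ((a : ℝ) + (b : ℝ) * Real.sqrt (m : ℝ))) :
    (∃ k : ℤ, (1 - (a : ℚ) * x) / (1 - 2 * (a : ℚ) * x - x ^ 2) = (k : ℚ)) ↔
      ((∃ n : ℕ, x = (Fm a b (2 * n) : ℚ) / (Fm a b (2 * n + 1) : ℚ)) ∨
       (∃ n : ℕ, x = (Lm a (2 * n + 1) : ℚ) / (Lm a (2 * n + 2) : ℚ))) := by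
  have hb0 : (b : ℚ) ≠ 0 := by exact_mod_cast hb.ne'
  have hF (n : ℕ) : (Fm a b (2 * n) : ℚ) / Fm a b (2 * n + 1) =
      Fm a 1 (2 * n) / Fm a 1 (2 * n + 1) := by
    rw [Fm_eq_mul a b, Fm_eq_mul a b (2 * n + 1)]; push_cast
    exact mul_div_mul_left _ _ hb0
  simp only [hF]
  constructor
  · rintro ⟨k, hk⟩
    obtain ⟨hx, hden, hnum⟩ := bounds_of_abs_lt_radius hm ha hb hab hconv
    have hk0 : 0 < k := by
      have := div_pos hnum hden
      rw [hk] at this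
      exact_mod_cast this
    rw [div_eq_iff hden.ne'] at hk
    obtain ⟨s, hs₁, hs₂⟩ := exists_index_of_value ha hk0 hx hk
    obtain ⟨hL, -⟩ := Lm_Fm_succ a s
    obtain ⟨-, hF'⟩ := Lm_Fm_succ a s
    have hN := Lm_sq_sub a s
    rw [(Lm_Fm_succ a (2 * s)).2, (Lm_Fm_two_mul a s).1, (Lm_Fm_two_mul a s).2] at hs₁
    rw [(Lm_Fm_two_mul a s).2] at hs₂
    push_cast at hs₂
    rcases Nat.even_or_odd' s with ⟨n, rfl | rfl⟩
    · left
      refine ⟨n, ?_⟩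
      have hpos : (0 : ℚ) < Fm a 1 (2 * n + 1) := by exact_mod_cast Fm_succ_pos ha (2 * n)
      have hLpos : (0 : ℚ) < Lm a (2 * n) := by exact_mod_cast (Lm_pos_Fm_nonneg ha (2 * n)).1
      rw [Even.neg_one_pow ⟨n, by ring⟩] at hN
      have hk2 : k = Lm a (2 * n) * Fm a 1 (2 * n + 1) := by
        rw [hF']; linarith
      rw [eq_div_iff hpos.ne']
      refine mul_left_cancel₀ hLpos.ne' ?_
      rw [hk2] at hs₂; push_cast at hs₂
      linarith
    · right
      refine ⟨n, ?_⟩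
      have hpos : (0 : ℚ) < Fm a 1 (2 * n + 1) := by exact_mod_cast Fm_succ_pos ha (2 * n)
      have hLpos : (0 : ℚ) < Lm a (2 * n + 2) := by
        exact_mod_cast (Lm_pos_Fm_nonneg ha (2 * n + 2)).1
      rw [Odd.neg_one_pow ⟨n, rfl⟩] at hN
      have hk2 : k = Fm a 1 (2 * n + 1) * Lm a (2 * n + 2) := by
        rw [hL]; linarith
      rw [eq_div_iff hLpos.ne']
      refine mul_left_cancel₀ hpos.ne' ?_
      rw [hk2] at hs₂; push_cast at hs₂
      linarith
  · rintro (⟨n, rfl⟩ | ⟨n, rfl⟩)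
    · refine ⟨Fm a 1 (2 * n + 1) * Lm a (2 * n), ?_⟩
      have hpos : (Fm a 1 (2 * n + 1) : ℚ) ≠ 0 := by exact_mod_cast (Fm_succ_pos ha (2 * n)).ne'
      have hN := Lm_sq_sub a (2 * n)
      rw [Even.neg_one_pow ⟨n, by ring⟩] at hN
      have hN' : (Lm a (2 * n) : ℚ) ^ 2 - (a ^ 2 + 1) * Fm a 1 (2 * n) ^ 2 = 1 := by
        exact_mod_cast hN
      have hF' : (Fm a 1 (2 * n + 1) : ℚ) = Lm a (2 * n) + a * Fm a 1 (2 * n) := by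
        exact_mod_cast (Lm_Fm_succ a (2 * n)).2
      have hden : 1 - 2 * (a : ℚ) * (Fm a 1 (2 * n) / Fm a 1 (2 * n + 1)) -
          (Fm a 1 (2 * n) / Fm a 1 (2 * n + 1)) ^ 2 = 1 / (Fm a 1 (2 * n + 1) : ℚ) ^ 2 := by
        field_simp
        rw [hF']; linear_combination hN'
      rw [hden]
      push_cast
      field_simp
      rw [hF']; ring
    · refine ⟨Lm a (2 * n + 2) * Fm a 1 (2 * n + 1), ?_⟩
      have hpos : (Lm a (2 * n + 2) : ℚ) ≠ 0 := by
        exact_mod_cast (Lm_pos_Fm_nonneg ha (2 * n + 2)).1.ne'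
      have hN := Lm_sq_sub a (2 * n + 1)
      rw [Odd.neg_one_pow ⟨n, rfl⟩] at hN
      have hN' : (Lm a (2 * n + 1) : ℚ) ^ 2 - (a ^ 2 + 1) * Fm a 1 (2 * n + 1) ^ 2 = -1 := by
        exact_mod_cast hN
      have hL' : (Lm a (2 * n + 2) : ℚ) =
          a * Lm a (2 * n + 1) + (a ^ 2 + 1) * Fm a 1 (2 * n + 1) := by
        exact_mod_cast (Lm_Fm_succ a (2 * n + 1)).1
      have hden : 1 - 2 * (a : ℚ) * (Lm a (2 * n + 1) / Lm a (2 * n + 2)) -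
          (Lm a (2 * n + 1) / Lm a (2 * n + 2)) ^ 2 =
            (a ^ 2 + 1) / (Lm a (2 * n + 2) : ℚ) ^ 2 := by
        field_simp
        rw [hL']; linear_combination -(a ^ 2 + 1 : ℚ) * hN'
      have ha2 : (a : ℚ) ^ 2 + 1 ≠ 0 := by positivity
      rw [hden]
      push_cast
      field_simp
      rw [hL']; ring
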